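/- Let α > 0 with α ≠ 1 and β ≤ α with β ≠ 1 be real parameters, and let p, q ∈ P_n. Let w ∈ P_n satisfy Σ_{i=1}^k w_i = min(Σ_{i=1}^k p_i, Σ_{i=1}^k q_i) for all k = 1, …, n (so w = p ∧ q is the greatest lower bound of p and q under majorization), and let v ∈ P_n be a least upper bound of p and q under majorization, i.e., p ⪯ v, q ⪯ v, and for every u ∈ P_n with p ⪯ u and q ⪯ u one has v ⪯ u. Then S_{α,β}(p) + S_{α,β}(q) ≤ S_{α,β}(w) + S_{α,β}(v). -/

import Mathlib

open Finset Real

/-- `p` is a probability vector: nonnegative, non-increasing entries summing to 1. -/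
def IsProbVec {n : ℕ} (p : Fin n → ℝ) : Prop :=
  (∀ i, 0 ≤ p i) ∧ (∀ i j : Fin n, i ≤ j → p j ≤ p i) ∧ ∑ i, p i = 1

/-- The sum of the first `k` entries of `p`. -/
noncomputable def partialSum {n : ℕ} (p : Fin n → ℝ) (k : ℕ) : ℝ :=
  ∑ i : Fin n, if (i : ℕ) < k then p i else 0

/-- `p` is majorized by `q` (`p ⪯ q`). -/
def MajorizedBy {n : ℕ} (p q : Fin n → ℝ) : Prop :=
  ∀ k : ℕ, k ≤ n → partialSum p k ≤ partialSum q k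

/-- The Sharma–Mittal entropy of order `(α, β)`. -/
noncomputable def sharmaMittal (α β : ℝ) {n : ℕ} (p : Fin n → ℝ) : ℝ :=
  (1 / (1 - β)) * ((∑ i, p i ^ α) ^ ((1 - β) / (1 - α)) - 1)

lemma ConcaveOn.exists_supporting_line {ψ : ℝ → ℝ} {s : Set ℝ} (hψ : ConcaveOn ℝ s ψ) {x : ℝ}
    (hx : x ∈ interior s) : ∃ c : ℝ, ∀ y ∈ s, ψ y ≤ ψ x + c * (y - x) := by
  have hc : ConvexOn ℝ s (-ψ) := hψ.neg
  refine ⟨-derivWithin (-ψ) (Set.Ioi x) x, fun y hy => ?_⟩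
  rcases lt_trichotomy x y with h | rfl | h
  · have h1 := hc.rightDeriv_le_slope_of_mem_interior hx hy h
    rw [slope_def_field, le_div_iff₀ (sub_pos.2 h)] at h1
    simp only [Pi.neg_apply] at h1
    linarith
  · simp
  · have h1 := (hc.slope_le_leftDeriv_of_mem_interior hy hx h).trans
      (hc.leftDeriv_le_rightDeriv_of_mem_interior hx)
    rw [slope_def_field, div_le_iff₀ (sub_pos.2 h)] at h1
    simp only [Pi.neg_apply] at h1
    linarith

/-- For a convex function, moving two points towards each other while preserving their sum
decreases the sum of the values. -/
lemma ConvexOn.add_le_add_of_add_eq {h : ℝ → ℝ} {s : Set ℝ} (hh : ConvexOn ℝ s h)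
    {a b c d : ℝ} (ha : a ∈ s) (hd : d ∈ s) (hab : a ≤ b) (hac : a ≤ c) (hsum : b + c = a + d) :
    h b + h c ≤ h a + h d := by
  rcases eq_or_lt_of_le (show a ≤ d by linarith) with rfl | had
  · obtain rfl : b = a := by linarith
    obtain rfl : c = b := by linarith
    exact le_rfl
  · have hpos : 0 < d - a := sub_pos.2 had
    have key : ∀ x, a ≤ x → x ≤ d → h x ≤ (d - x) / (d - a) * h a + (x - a) / (d - a) * h d := by
      intro x hax hxd
      have h1 := hh.2 ha hd (div_nonneg (sub_nonneg.2 hxd) hpos.le)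
        (div_nonneg (sub_nonneg.2 hax) hpos.le)
        (by rw [← add_div, div_eq_one_iff_eq hpos.ne']; ring)
      have e : (d - x) / (d - a) * a + (x - a) / (d - a) * d = x := by
        have := hpos.ne'
        field_simp
        ring
      simpa only [smul_eq_mul, e] using h1
    have hb := key b hab (by linarith)
    have hc := key c hac (by linarith)
    have e1 : d - b = c - a := by linarith
    have e2 : d - c = b - a := by linarith
    have e3 : (c - a) / (d - a) + (b - a) / (d - a) = 1 := by
      rw [← add_div, div_eq_one_iff_eq hpos.ne']; linarith
    rw [e1] at hb
    rw [e2] at hc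
    calc h b + h c ≤ ((c - a) / (d - a) + (b - a) / (d - a)) * (h a + h d) := by linarith
      _ = h a + h d := by rw [e3, one_mul]

lemma ConcaveOn.add_le_add_of_add_eq {h : ℝ → ℝ} {s : Set ℝ} (hh : ConcaveOn ℝ s h)
    {a b c d : ℝ} (ha : a ∈ s) (hd : d ∈ s) (hab : a ≤ b) (hac : a ≤ c) (hsum : b + c = a + d) :
    h a + h d ≤ h b + h c := by
  have := hh.neg.add_le_add_of_add_eq ha hd hab hac hsum
  simp only [Pi.neg_apply] at this
  linarith

lemma convexOn_rpow_of_nonpos {r : ℝ} (hr : r ≤ 0) :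
    ConvexOn ℝ (Set.Ioi 0) fun x : ℝ => x ^ r := by
  have h1 : ConvexOn ℝ (Set.Ioi 0) fun x : ℝ => r * Real.log x := by
    have := strictConcaveOn_log_Ioi.concaveOn.neg.smul (neg_nonneg.2 hr)
    simpa using this
  refine ⟨convex_Ioi 0, fun x hx y hy a b ha hb hab => ?_⟩
  have hz : a • x + b • y ∈ Set.Ioi (0 : ℝ) := convex_Ioi 0 hx hy ha hb hab
  simp only [Real.rpow_def_of_pos hx, Real.rpow_def_of_pos hy, Real.rpow_def_of_pos hz,
    mul_comm _ r]
  exact (Real.exp_le_exp.2 (h1.2 hx hy ha hb hab)).trans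
    (convexOn_exp.2 (Set.mem_univ _) (Set.mem_univ _) ha hb hab)

lemma partialSum_zero {n : ℕ} (p : Fin n → ℝ) : partialSum p 0 = 0 := by
  simp [partialSum]

lemma partialSum_self {n : ℕ} (p : Fin n → ℝ) : partialSum p n = ∑ i, p i := by
  simp [partialSum]

lemma partialSum_succ {n : ℕ} (p : Fin n → ℝ) (k : Fin n) :
    partialSum p (k + 1) = partialSum p k + p k := by
  have h : p k = ∑ i : Fin n, if i = k then p i else 0 := by simp
  rw [partialSum, partialSum, h, ← Finset.sum_add_distrib]
  refine Finset.sum_congr rfl fun i _ => ?_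
  have : i = k ↔ (i : ℕ) = k := Fin.ext_iff
  split_ifs <;> first | omega | simp

lemma partialSum_add {n : ℕ} (p q : Fin n → ℝ) (k : ℕ) :
    partialSum (p + q) k = partialSum p k + partialSum q k := by
  rw [partialSum, partialSum, partialSum, ← Finset.sum_add_distrib]
  exact Finset.sum_congr rfl fun i _ => by split_ifs <;> simp

lemma partialSum_sub {n : ℕ} (p q : Fin n → ℝ) (k : ℕ) :
    partialSum (p - q) k = partialSum p k - partialSum q k := by
  rw [partialSum, partialSum, partialSum, ← Finset.sum_sub_distrib]
  exact Finset.sum_congr rfl fun i _ => by split_ifs <;> simp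

lemma partialSum_single {n : ℕ} (j : Fin n) (δ : ℝ) (k : ℕ) :
    partialSum (Pi.single j δ) k = if (j : ℕ) < k then δ else 0 := by
  rw [partialSum, Finset.sum_eq_single j]
  · simp
  · intro i _ hij
    simp [hij]
  · simp

/-- A consequence of Abel summation. -/
lemma sum_mul_nonpos_of_partialSum {n : ℕ} (c d : Fin n → ℝ) (hd : ∑ i, d i = 0)
    (h : ∀ (k : ℕ) (hk : k + 1 < n),
      0 ≤ (c ⟨k + 1, hk⟩ - c ⟨k, k.lt_succ_self.trans hk⟩) * partialSum d (k + 1)) :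
    ∑ i, c i * d i ≤ 0 := by
  have key : ∀ (m : ℕ) (hm : m < n),
      partialSum (fun i => c i * d i) (m + 1) ≤ c ⟨m, hm⟩ * partialSum d (m + 1) := by
    intro m
    induction m with
    | zero =>
      intro hm
      have h1 := partialSum_succ (fun i => c i * d i) ⟨0, hm⟩
      have h2 := partialSum_succ d ⟨0, hm⟩
      simp only [partialSum_zero] at h1 h2
      rw [h1, h2]
      simp
    | succ m ih =>
      intro hm
      have h1 := partialSum_succ (fun i => c i * d i) ⟨m + 1, hm⟩
      have h2 := partialSum_succ d ⟨m + 1, hm⟩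
      have h3 := ih (m.lt_succ_self.trans hm)
      have h4 := h m hm
      simp only at h1 h2
      rw [h1, h2]
      linarith
  rcases n with _ | m
  · simp
  · have := key m m.lt_succ_self
    rwa [partialSum_self, partialSum_self, hd, mul_zero] at this

open Filter Topology in
open Filter Topology in
/-- If the partial sums of `u` dominate those of the non-increasing vector `v` wherever `v`
strictly decreases, then `v` has the larger sum of values under any concave function. -/
lemma ConcaveOn.sum_le_sum_of_partialSum {ψ : ℝ → ℝ} (hψ : ConcaveOn ℝ (Set.Ici 0) ψ)
    (hcont : ContinuousOn ψ (Set.Ici 0)) {n : ℕ} {u v : Fin n → ℝ} (hu : ∀ i, 0 ≤ u i)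
    (hv : ∀ i, 0 ≤ v i) (hmono : Antitone v) (hsum : ∑ i, u i = ∑ i, v i)
    (h : ∀ (k : ℕ) (hk : k + 1 < n), v ⟨k + 1, hk⟩ < v ⟨k, k.lt_succ_self.trans hk⟩ →
      partialSum v (k + 1) ≤ partialSum u (k + 1)) :
    ∑ i, ψ (u i) ≤ ∑ i, ψ (v i) := by
  have key : ∀ ε > 0, ∑ i, ψ (u i + ε) ≤ ∑ i, ψ (v i + ε) := by
    intro ε hε
    have hex : ∀ x : ℝ, ∃ c : ℝ, 0 < x → ∀ y, 0 ≤ y → ψ y ≤ ψ x + c * (y - x) := by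
      intro x
      by_cases hx : 0 < x
      · obtain ⟨c, hc⟩ := hψ.exists_supporting_line (x := x) (by simpa using hx)
        exact ⟨c, fun _ => hc⟩
      · exact ⟨0, fun h => absurd h hx⟩
    choose D hD using hex
    have hvε : ∀ i, 0 < v i + ε := fun i => add_pos_of_nonneg_of_pos (hv i) hε
    have h1 : ∑ i, D (v i + ε) * (u - v) i ≤ 0 := by
      refine sum_mul_nonpos_of_partialSum (fun i => D (v i + ε)) (u - v) ?_ fun k hk => ?_
      · simp [hsum]
      · have hle : v ⟨k + 1, hk⟩ ≤ v ⟨k, k.lt_succ_self.trans hk⟩ :=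
          hmono (Fin.mk_le_mk.2 k.le_succ)
        rcases eq_or_lt_of_le hle with he | hlt
        · simp [he]
        · refine mul_nonneg ?_ ?_
          · have a1 := hD _ (hvε ⟨k + 1, hk⟩) _ (hvε ⟨k, k.lt_succ_self.trans hk⟩).le
            have a2 := hD _ (hvε ⟨k, k.lt_succ_self.trans hk⟩) _ (hvε ⟨k + 1, hk⟩).le
            refine nonneg_of_mul_nonneg_left ?_ (sub_pos.2 hlt)
            linarith
          · rw [partialSum_sub, sub_nonneg]
            exact h k hk hlt
    calc ∑ i, ψ (u i + ε) ≤ ∑ i, (ψ (v i + ε) + D (v i + ε) * (u - v) i) := by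
          refine Finset.sum_le_sum fun i _ => ?_
          have := hD _ (hvε i) (u i + ε) (add_nonneg (hu i) hε.le)
          simpa using this
      _ ≤ ∑ i, ψ (v i + ε) := by
          rw [Finset.sum_add_distrib]
          linarith
  have lim : ∀ x : Fin n → ℝ, (∀ i, 0 ≤ x i) →
      Tendsto (fun ε => ∑ i, ψ (x i + ε)) (𝓝[>] 0) (𝓝 (∑ i, ψ (x i))) := by
    intro x hx
    refine tendsto_finsetSum _ fun i _ => ?_
    refine (hcont (x i) (hx i)).tendsto.comp (tendsto_nhdsWithin_iff.2 ⟨?_, ?_⟩)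
    · have : Tendsto (fun ε : ℝ => x i + ε) (𝓝 0) (𝓝 (x i + 0)) :=
        tendsto_const_nhds.add tendsto_id
      rw [add_zero] at this
      exact this.mono_left nhdsWithin_le_nhds
    · filter_upwards [self_mem_nhdsWithin] with ε hε
      exact add_nonneg (hx i) (le_of_lt hε)
  exact le_of_tendsto_of_tendsto (lim u hu) (lim v hv)
    (by filter_upwards [self_mem_nhdsWithin] with ε hε using key ε hε)

/-- Schur concavity of sums of a concave function. -/
lemma MajorizedBy.sum_concaveOn_le {ψ : ℝ → ℝ} (hψ : ConcaveOn ℝ (Set.Ici 0) ψ)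
    (hcont : ContinuousOn ψ (Set.Ici 0)) {n : ℕ} {p q : Fin n → ℝ} (hp : IsProbVec p)
    (hq : IsProbVec q) (hpq : MajorizedBy p q) : ∑ i, ψ (q i) ≤ ∑ i, ψ (p i) :=
  hψ.sum_le_sum_of_partialSum hcont hq.1 hp.1 (fun i j hij => hp.2.1 i j hij)
    (hq.2.2.trans hp.2.2.symm) fun k hk _ => hpq (k + 1) hk.le

/-- A least upper bound touches the upper envelope of the partial sums wherever it strictly
decreases. -/
lemma partialSum_le_max_of_lub {n : ℕ} {p q v : Fin n → ℝ} (hv : IsProbVec v)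
    (hpv : MajorizedBy p v) (hqv : MajorizedBy q v)
    (hlub : ∀ u : Fin n → ℝ, IsProbVec u → MajorizedBy p u → MajorizedBy q u →
      MajorizedBy v u) (k : ℕ) (hk : k + 1 < n)
    (hlt : v ⟨k + 1, hk⟩ < v ⟨k, k.lt_succ_self.trans hk⟩) :
    partialSum v (k + 1) ≤ max (partialSum p (k + 1)) (partialSum q (k + 1)) := by
  by_contra! hcon
  set a : Fin n := ⟨k, k.lt_succ_self.trans hk⟩ with ha
  set b : Fin n := ⟨k + 1, hk⟩ with hb
  set M := max (partialSum p (k + 1)) (partialSum q (k + 1)) with hM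
  obtain ⟨δ, hδ, hδ1, hδ2⟩ : ∃ δ > 0, δ ≤ (v a - v b) / 2 ∧ δ ≤ partialSum v (k + 1) - M :=
    ⟨min ((v a - v b) / 2) (partialSum v (k + 1) - M),
      lt_min (by linarith) (by linarith), min_le_left _ _, min_le_right _ _⟩
  set u : Fin n → ℝ := v - Pi.single a δ + Pi.single b δ with hu
  have hval : ∀ i : Fin n,
      u i = v i - (if (i : ℕ) = k then δ else 0) + (if (i : ℕ) = k + 1 then δ else 0) := by
    intro i
    simp [hu, Pi.single_apply, Fin.ext_iff, ha, hb]
  have hpart : ∀ m : ℕ, partialSum u m = partialSum v m - if m = k + 1 then δ else 0 := by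
    intro m
    rw [hu, partialSum_add, partialSum_sub, partialSum_single, partialSum_single]
    simp only [ha, hb]
    split_ifs <;> first | omega | ring
  have hub : IsProbVec u := by
    have hvb := hv.1 b
    refine ⟨fun i => ?_, fun i j hij => ?_, ?_⟩
    · have hvi := hv.1 i
      rw [hval]
      split_ifs with h1 h2 h2
      · omega
      · obtain rfl : i = a := Fin.ext h1
        linarith
      · linarith
      · linarith
    · have hvij := hv.2.1 i j hij
      have hij' : (i : ℕ) ≤ j := hij
      rw [hval, hval]
      by_cases hia : (i : ℕ) = k
      · obtain rfl : i = a := Fin.ext hia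
        by_cases hja : (j : ℕ) = k
        · obtain rfl : j = a := Fin.ext hja
          exact le_rfl
        · have hjb : v j ≤ v b := hv.2.1 b j (by rw [Fin.le_def, hb]; simp only; omega)
          simp only [hia, hja, if_true, if_false]
          split_ifs <;> first | omega | linarith
      · by_cases hjb : (j : ℕ) = k + 1
        · obtain rfl : j = b := Fin.ext hjb
          by_cases hib : (i : ℕ) = k + 1
          · obtain rfl : i = b := Fin.ext hib
            exact le_rfl
          · have hia' : v a ≤ v i := hv.2.1 i a (by rw [Fin.le_def, ha]; simp only; omega)
            simp only [hia, hib, hjb, if_true, if_false]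
            split_ifs <;> first | omega | linarith
        · simp only [hia, hjb, if_false]
          split_ifs <;> linarith
    · rw [← partialSum_self, hpart, partialSum_self, hv.2.2, if_neg hk.ne', sub_zero]
  have hbound : ∀ r : Fin n → ℝ, MajorizedBy r v → partialSum r (k + 1) ≤ M →
      MajorizedBy r u := by
    intro r hr hrM m hm
    rw [hpart]
    split_ifs with h
    · subst h
      linarith
    · simpa using hr m hm
  have := hlub u hub (hbound p hpv (le_max_left _ _)) (hbound q hqv (le_max_right _ _))
    (k + 1) hk.le
  rw [hpart, if_pos rfl] at this
  linarith

/-- Sums of a concave function are supermodular on the majorization lattice. -/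
lemma ConcaveOn.sum_supermodular {ψ : ℝ → ℝ} (hψ : ConcaveOn ℝ (Set.Ici 0) ψ)
    (hcont : ContinuousOn ψ (Set.Ici 0)) {n : ℕ} {p q w v : Fin n → ℝ}
    (hp : IsProbVec p) (hq : IsProbVec q) (hw : IsProbVec w) (hv : IsProbVec v)
    (hglb : ∀ k : ℕ, k ≤ n → partialSum w k = min (partialSum p k) (partialSum q k))
    (hpv : MajorizedBy p v) (hqv : MajorizedBy q v)
    (hlub : ∀ u : Fin n → ℝ, IsProbVec u → MajorizedBy p u → MajorizedBy q u →
      MajorizedBy v u) :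
    ∑ i, ψ (p i) + ∑ i, ψ (q i) ≤ ∑ i, ψ (w i) + ∑ i, ψ (v i) := by
  set u : Fin n → ℝ := p + q - w with hu
  have hui : ∀ i, u i = p i + q i - w i := fun i => rfl
  have hw_mem : ∀ i, min (p i) (q i) ≤ w i ∧ w i ≤ max (p i) (q i) := by
    intro i
    have e1 := hglb i i.2.le
    have e2 := hglb (i + 1) i.2
    rw [partialSum_succ, partialSum_succ, partialSum_succ] at e2
    grind
  have hu0 : ∀ i, 0 ≤ u i := by
    intro i
    have h1 := hp.1 i
    have h2 := hq.1 i
    have h3 := hw_mem i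
    rw [hui]
    grind
  have h1 : ∑ i, ψ (u i) ≤ ∑ i, ψ (v i) := by
    refine hψ.sum_le_sum_of_partialSum hcont hu0 hv.1 (fun i j hij => hv.2.1 i j hij) ?_ ?_
    · simp only [hui, Finset.sum_add_distrib, Finset.sum_sub_distrib, hp.2.2, hq.2.2, hw.2.2,
        hv.2.2]
      norm_num
    · intro k hk hlt
      rw [hu, partialSum_sub, partialSum_add, hglb _ hk.le]
      have := partialSum_le_max_of_lub hv hpv hqv hlub k hk hlt
      linarith [min_add_max (partialSum p (k + 1)) (partialSum q (k + 1))]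
  have h2 : ∀ i, ψ (p i) + ψ (q i) ≤ ψ (w i) + ψ (u i) := by
    intro i
    have hmem := hw_mem i
    rcases le_total (p i) (q i) with h | h
    · rw [min_eq_left h, max_eq_right h] at hmem
      exact hψ.add_le_add_of_add_eq (hp.1 i) (hq.1 i) hmem.1 (by rw [hui]; linarith)
        (by rw [hui]; ring)
    · rw [min_eq_right h, max_eq_left h] at hmem
      rw [add_comm (ψ (p i))]
      exact hψ.add_le_add_of_add_eq (hq.1 i) (hp.1 i) hmem.1 (by rw [hui]; linarith)
        (by rw [hui]; ring)
  calc ∑ i, ψ (p i) + ∑ i, ψ (q i) = ∑ i, (ψ (p i) + ψ (q i)) :=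
        Finset.sum_add_distrib.symm
    _ ≤ ∑ i, (ψ (w i) + ψ (u i)) := Finset.sum_le_sum fun i _ => h2 i
    _ ≤ ∑ i, ψ (w i) + ∑ i, ψ (v i) := by
        rw [Finset.sum_add_distrib]
        linarith

lemma IsProbVec.sum_rpow_pos {n : ℕ} {p : Fin n → ℝ} (hp : IsProbVec p) (α : ℝ) :
    0 < ∑ i, p i ^ α := by
  obtain ⟨i, -, hi⟩ : ∃ i ∈ Finset.univ, 0 < p i := by
    apply Finset.exists_lt_of_sum_lt
    simp [hp.2.2]
  exact Finset.sum_pos' (fun j _ => Real.rpow_nonneg (hp.1 j) α)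
    ⟨i, Finset.mem_univ i, Real.rpow_pos_of_pos hi α⟩

/-- For `α > 0`, `α ≠ 1`, `β ≤ α`, `β ≠ 1`, the Sharma–Mittal entropy is supermodular
on the majorization lattice: `S(p) + S(q) ≤ S(p ∧ q) + S(p ∨ q)`. -/
theorem sharmaMittal_supermodular {n : ℕ} (α β : ℝ) (hα0 : 0 < α) (hα1 : α ≠ 1)
    (hβα : β ≤ α) (hβ1 : β ≠ 1) (p q w v : Fin n → ℝ)
    (hp : IsProbVec p) (hq : IsProbVec q) (hw : IsProbVec w) (hv : IsProbVec v)
    (hglb : ∀ k : ℕ, k ≤ n → partialSum w k = min (partialSum p k) (partialSum q k))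
    (hpv : MajorizedBy p v) (hqv : MajorizedBy q v)
    (hlub : ∀ u : Fin n → ℝ, IsProbVec u → MajorizedBy p u → MajorizedBy q u →
      MajorizedBy v u) :
    sharmaMittal α β p + sharmaMittal α β q
      ≤ sharmaMittal α β w + sharmaMittal α β v := by
  have hcont : ContinuousOn (fun x : ℝ => x ^ α) (Set.Ici 0) :=
    (Real.continuous_rpow_const hα0.le).continuousOn
  have hwp : MajorizedBy w p := fun k hk => (hglb k hk).trans_le (min_le_left _ _)
  have hwq : MajorizedBy w q := fun k hk => (hglb k hk).trans_le (min_le_right _ _)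
  have Pp := hp.sum_rpow_pos α
  have Pq := hq.sum_rpow_pos α
  have Pw := hw.sum_rpow_pos α
  have Pv := hv.sum_rpow_pos α
  set r := (1 - β) / (1 - α) with hr
  simp only [sharmaMittal]
  rw [← hr]
  rcases lt_or_gt_of_ne hα1 with hα | hα
  · have hconc : ConcaveOn ℝ (Set.Ici 0) (fun x : ℝ => x ^ α) :=
      Real.concaveOn_rpow hα0.le hα.le
    have hs := hconc.sum_supermodular hcont hp hq hw hv hglb hpv hqv hlub
    have hvp := hpv.sum_concaveOn_le hconc hcont hp hv
    have hvq := hqv.sum_concaveOn_le hconc hcont hq hv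
    have hr1 : 1 ≤ r := by
      rw [hr, le_div_iff₀ (by linarith)]
      linarith
    have hconv := convexOn_rpow hr1
    have h4 := hconv.add_le_add_of_add_eq (a := ∑ i, v i ^ α)
      (d := ∑ i, p i ^ α + ∑ i, q i ^ α - ∑ i, v i ^ α) Pv.le
      (by rw [Set.mem_Ici]; linarith) hvp hvq (by ring)
    have h5 : (∑ i, p i ^ α + ∑ i, q i ^ α - ∑ i, v i ^ α) ^ r ≤ (∑ i, w i ^ α) ^ r :=
      Real.rpow_le_rpow (by linarith) (by linarith) (by linarith)
    have h6 : 0 ≤ 1 / (1 - β) := one_div_nonneg.2 (by linarith)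
    rw [← mul_add, ← mul_add]
    exact mul_le_mul_of_nonneg_left (by linarith) h6
  · have hconc : ConcaveOn ℝ (Set.Ici 0) (-fun x : ℝ => x ^ α) := (convexOn_rpow hα.le).neg
    have hs := hconc.sum_supermodular hcont.neg hp hq hw hv hglb hpv hqv hlub
    have hwp' := hwp.sum_concaveOn_le hconc hcont.neg hw hp
    have hwq' := hwq.sum_concaveOn_le hconc hcont.neg hw hq
    simp only [Pi.neg_apply, Finset.sum_neg_distrib] at hs hwp' hwq'
    have hle : ∑ i, v i ^ α ≤ ∑ i, p i ^ α + ∑ i, q i ^ α - ∑ i, w i ^ α := by linarith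
    have hpos := Pv.trans_le hle
    rw [← mul_add, ← mul_add]
    rcases lt_or_gt_of_ne hβ1 with hβ | hβ
    · have hr0 : r ≤ 0 := div_nonpos_of_nonneg_of_nonpos (by linarith) (by linarith)
      have h4 := (convexOn_rpow_of_nonpos hr0).add_le_add_of_add_eq (a := ∑ i, w i ^ α)
        Pw hpos (by linarith : _ ≤ ∑ i, p i ^ α) (by linarith : _ ≤ ∑ i, q i ^ α) (by ring)
      have h5 := Real.rpow_le_rpow_of_nonpos Pv hle hr0
      have h6 : 0 ≤ 1 / (1 - β) := one_div_nonneg.2 (by linarith)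
      exact mul_le_mul_of_nonneg_left (by linarith) h6
    · have hr0 : 0 ≤ r := div_nonneg_of_nonpos (by linarith) (by linarith)
      have hr1 : r ≤ 1 := by
        rw [hr, div_le_one_of_neg (by linarith)]
        linarith
      have h4 := (Real.concaveOn_rpow hr0 hr1).add_le_add_of_add_eq (a := ∑ i, w i ^ α)
        Pw.le hpos.le (by linarith : _ ≤ ∑ i, p i ^ α) (by linarith : _ ≤ ∑ i, q i ^ α)
        (by ring)
      have h5 := Real.rpow_le_rpow Pv.le hle hr0
      have h6 : 1 / (1 - β) ≤ 0 := one_div_nonpos.2 (by linarith)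
      exact mul_le_mul_of_nonpos_left (by linarith) h6
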